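/- arXiv:1108.5129 — 2 statements merged into one kernel-verified Lean document; each statement's English description precedes it below -/
import Mathlib

section
/- There exists a universal constant C₂' > 0 such that for every α ∈ ℝ, every N ≥ 2, every normalized N-anyon wave function u with one-particle density ρ, and every square Q ⊂ ℝ² with area |Q| and with ∫_Q ρ > 0: ∑_{j=1}^N ∫_{(ℝ²)^N} |D_j u|² χ_Q(x_j) dx ≥ C₂' · (∫_Q ρ)^{−1} · ∫_Q [ρ(x)^{1/2} − ((∫_Q ρ)/|Q|)^{1/2}]₊⁴ dx. -/
open MeasureTheory

noncomputable section

/-- Squared magnitude of the covariant derivative `D_j u` at configuration `x`;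
the plane `ℝ²` is identified with `ℂ` (so `a^⊥ = I·a`, and the two components of a
vector field are the real and imaginary parts). -/
def covSq (α : ℝ) {N : ℕ} (u : (Fin N → ℂ) → ℂ) (j : Fin N) (x : Fin N → ℂ) : ℝ :=
  let A : ℂ := (α : ℂ) * ∑ k ∈ Finset.univ.erase j,
    Complex.I * (x j - x k) / ((‖x j - x k‖ : ℂ) ^ 2)
  ‖-Complex.I * fderiv ℝ u x (Pi.single j 1) + (A.re : ℂ) * u x‖ ^ 2 +
    ‖-Complex.I * fderiv ℝ u x (Pi.single j Complex.I) + (A.im : ℂ) * u x‖ ^ 2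

/-- The statistics constant `C_{α,N} = min_{p ∈ {0,…,N-2}} min_{q ∈ ℤ} |(2p+1)α - 2q|`. -/
def statC (α : ℝ) (N : ℕ) : ℝ :=
  ⨅ p : Fin (N - 1), ⨅ q : ℤ, |(2 * ((p : ℕ) : ℝ) + 1) * α - 2 * (q : ℝ)|

/-- `N`-anyon wave function in the magnetic gauge (smooth compactly supported
form-core representative): totally symmetric with support away from the diagonals. -/
structure IsAnyonWF (N : ℕ) (u : (Fin N → ℂ) → ℂ) : Prop where
  smooth : ContDiff ℝ (⊤ : ℕ∞) u
  compactSupport : HasCompactSupport u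
  symmetric : ∀ (σ : Equiv.Perm (Fin N)) (x : Fin N → ℂ), u (x ∘ σ) = u x
  offDiagonal : ∀ x ∈ tsupport u, ∀ j k : Fin N, j ≠ k → x j ≠ x k

/-- One-particle density of an `N`-particle wave function. -/
def density (N : ℕ) (u : (Fin N → ℂ) → ℂ) (y : ℂ) : ℝ :=
  ∑ j : Fin N, ∫ z : {k : Fin N // k ≠ j} → ℂ,
    ‖u (fun k => if h : k = j then y else z ⟨k, h⟩)‖ ^ 2

/-- An open square in the plane `ℂ ≅ ℝ²`, of arbitrary side length, center and
orientation: the image of `(0,L)²` under a plane isometry. -/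
def IsPlaneSquare (Q : Set ℂ) : Prop :=
  ∃ L : ℝ, 0 < L ∧ ∃ f : ℂ ≃ᵢ ℂ,
    Q = f '' {z : ℂ | z.re ∈ Set.Ioo 0 L ∧ z.im ∈ Set.Ioo 0 L}

theorem integral_sub_const_sq {X : Type*} [MeasurableSpace X] {μ : Measure X} [IsFiniteMeasure μ]
    {h : X → ℝ} (hi : Integrable h μ) (hi2 : Integrable (fun x => h x ^ 2) μ) (b : ℝ) :
    ∫ x, (h x - b) ^ 2 ∂μ =
      ∫ x, h x ^ 2 ∂μ - 2 * b * ∫ x, h x ∂μ + μ.real Set.univ * b ^ 2 := by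
  have e : (fun x => (h x - b) ^ 2) = fun x => (h x ^ 2 - 2 * b * h x) + b ^ 2 := by
    funext x; ring
  have hs : Integrable (fun x => h x ^ 2 - 2 * b * h x) μ := hi2.sub (hi.const_mul _)
  rw [e, integral_add hs (integrable_const _), integral_sub hi2 (hi.const_mul _),
    integral_const_mul, integral_const, smul_eq_mul]

theorem integral_const_add_mul {X : Type*} [MeasurableSpace X] {μ : Measure X} [IsFiniteMeasure μ]
    {h : X → ℝ} (hi : Integrable h μ) (b c : ℝ) :
    ∫ x, (b + c * h x) ∂μ = μ.real Set.univ * b + c * ∫ x, h x ∂μ := by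
  rw [integral_add (integrable_const _) (hi.const_mul _), integral_const_mul, integral_const,
    smul_eq_mul]

theorem sq_integral_le_measureReal_mul {X : Type*} [MeasurableSpace X] {μ : Measure X}
    [IsFiniteMeasure μ] {h : X → ℝ} (hi : Integrable h μ) (hi2 : Integrable (fun x => h x ^ 2) μ) :
    (∫ x, h x ∂μ) ^ 2 ≤ μ.real Set.univ * ∫ x, h x ^ 2 ∂μ := by
  rcases eq_or_ne μ 0 with rfl | hμ
  · simp
  have hM : 0 < μ.real Set.univ := by
    have : NeZero μ := ⟨hμ⟩
    exact measureReal_univ_pos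
  set M := μ.real Set.univ
  set I := ∫ x, h x ∂μ
  have h0 : 0 ≤ ∫ x, (h x - I / M) ^ 2 ∂μ := integral_nonneg fun x => sq_nonneg _
  have h1 : M * (∫ x, h x ^ 2 ∂μ - 2 * (I / M) * I + M * (I / M) ^ 2) =
      M * (∫ x, h x ^ 2 ∂μ) - I ^ 2 := by
    field_simp
    ring
  rw [integral_sub_const_sq hi hi2] at h0
  have := mul_nonneg hM.le h0
  linarith

/-- Lebesgue measure on the segment `[0, L]`. -/
abbrev segMeasure (L : ℝ) : Measure ℝ := volume.restrict (Set.Icc 0 L)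

theorem segMeasure_real_univ {L : ℝ} (hL : 0 ≤ L) : (segMeasure L).real Set.univ = L := by
  simp [Measure.real, hL]

theorem Continuous.integrable_segMeasure {h : ℝ → ℝ} (hc : Continuous h) (L : ℝ) :
    Integrable h (segMeasure L) := hc.integrableOn_Icc

theorem Continuous.integrable_segMeasure_prod {h : ℝ × ℝ → ℝ} (hc : Continuous h) (L : ℝ) :
    Integrable h ((segMeasure L).prod (segMeasure L)) := by
  rw [Measure.prod_restrict]
  exact hc.continuousOn.integrableOn_compact (isCompact_Icc.prod isCompact_Icc)

theorem continuous_integral_segMeasure_left {h : ℝ × ℝ → ℝ} (hc : Continuous h) (L : ℝ) :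
    Continuous fun s => ∫ t, h (s, t) ∂segMeasure L :=
  continuous_parametric_integral_of_continuous (f := fun s t => h (s, t)) hc isCompact_Icc

theorem continuous_integral_segMeasure_right {h : ℝ × ℝ → ℝ} (hc : Continuous h) (L : ℝ) :
    Continuous fun t => ∫ s, h (s, t) ∂segMeasure L :=
  continuous_parametric_integral_of_continuous (f := fun t s => h (s, t))
    (hc.comp continuous_swap) isCompact_Icc

theorem abs_sub_le_integral_segMeasure {L : ℝ} {h k : ℝ → ℝ} (hk : Continuous k)
    (hd : ∀ s, ∃ d, HasDerivAt h d s ∧ |d| ≤ k s) {a b : ℝ}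
    (ha : a ∈ Set.Icc 0 L) (hb : b ∈ Set.Icc 0 L) :
    |h b - h a| ≤ ∫ s, k s ∂segMeasure L := by
  wlog hab : a ≤ b generalizing a b
  · rw [abs_sub_comm]
    exact this hb ha (le_of_not_ge hab)
  choose d hd hdk using hd
  have hc : Continuous h := continuous_iff_continuousAt.2 fun s => (hd s).continuousAt
  have h1 : h b - h a ≤ ∫ s in a..b, k s :=
    intervalIntegral.sub_le_integral_of_hasDeriv_right_of_le hab hc.continuousOn
      (fun s _ => (hd s).hasDerivWithinAt) hk.integrableOn_Icc
      fun s _ => (le_abs_self _).trans (hdk s)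
  have h2 : -h b - -h a ≤ ∫ s in a..b, k s :=
    intervalIntegral.sub_le_integral_of_hasDeriv_right_of_le hab hc.neg.continuousOn
      (fun s _ => (hd s).neg.hasDerivWithinAt) hk.integrableOn_Icc
      fun s _ => (neg_le_abs _).trans (hdk s)
  have h3 : ∫ s in a..b, k s ≤ ∫ s, k s ∂segMeasure L := by
    rw [intervalIntegral.integral_of_le hab]
    refine setIntegral_mono_set hk.integrableOn_Icc
      (Filter.Eventually.of_forall fun s => (abs_nonneg _).trans (hdk s)) ?_
    exact LE.le.eventuallyLE fun s (hs : s ∈ Set.Ioc a b) => ⟨ha.1.trans hs.1.le, hs.2.trans hb.2⟩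
  rw [abs_le]
  constructor <;> linarith

theorem sq_sub_le_integral_segMeasure {L : ℝ} (hL : 0 ≤ L) {h k : ℝ → ℝ} (hk : Continuous k)
    (hd : ∀ s, ∃ d, HasDerivAt h d s ∧ d ^ 2 ≤ k s) {a b : ℝ}
    (ha : a ∈ Set.Icc 0 L) (hb : b ∈ Set.Icc 0 L) :
    (h b - h a) ^ 2 ≤ L * ∫ s, k s ∂segMeasure L := by
  have h0 : ∀ s, 0 ≤ k s := fun s => by
    obtain ⟨d, -, hd⟩ := hd s
    exact (sq_nonneg d).trans hd
  have h1 := abs_sub_le_integral_segMeasure (h := h) hk.sqrt (fun s => by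
    obtain ⟨d, hd, hdk⟩ := hd s
    exact ⟨d, hd, Real.abs_le_sqrt hdk⟩) ha hb
  have h2 := sq_integral_le_measureReal_mul (hk.sqrt.integrable_segMeasure L)
    ((hk.sqrt.pow 2).integrable_segMeasure L)
  simp only [Real.sq_sqrt (h0 _), segMeasure_real_univ hL] at h2
  calc (h b - h a) ^ 2 = |h b - h a| ^ 2 := (sq_abs _).symm
    _ ≤ _ := pow_le_pow_left₀ (abs_nonneg _) h1 2
    _ ≤ _ := h2

theorem le_average_add_integral_segMeasure {L : ℝ} (hL : 0 < L) {h k : ℝ → ℝ} (hk : Continuous k)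
    (hd : ∀ s, ∃ d, HasDerivAt h d s ∧ |d| ≤ k s) {a : ℝ} (ha : a ∈ Set.Icc 0 L) :
    h a ≤ L⁻¹ * ∫ s, h s ∂segMeasure L + ∫ s, k s ∂segMeasure L := by
  have hc : Continuous h := continuous_iff_continuousAt.2 fun s =>
    (hd s).choose_spec.1.continuousAt
  have h1 : ∫ s, h a ∂segMeasure L ≤ ∫ s, (h s + ∫ r, k r ∂segMeasure L) ∂segMeasure L := by
    refine setIntegral_mono_on continuous_const.integrableOn_Icc (hc.add continuous_const).integrableOn_Icc
      measurableSet_Icc fun s hs => ?_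
    have := (le_abs_self _).trans (abs_sub_le_integral_segMeasure (h := h) hk hd hs ha)
    linarith
  rw [integral_add (hc.integrable_segMeasure L) (integrable_const _), integral_const,
    integral_const, segMeasure_real_univ hL.le, smul_eq_mul, smul_eq_mul] at h1
  have h2 : h a = L⁻¹ * (L * h a) := by field_simp
  rw [h2]
  calc L⁻¹ * (L * h a) ≤ L⁻¹ * (∫ s, h s ∂segMeasure L + L * ∫ r, k r ∂segMeasure L) := by gcongr
    _ = _ := by field_simp

section Square

variable {L : ℝ} {F τ : ℝ × ℝ → ℝ}

theorem integral_sq_sub_average_le (hL : 0 < L) (hF : Continuous F) (hτ : Continuous τ)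
    (hd1 : ∀ s t, ∃ d, HasDerivAt (fun r => F (r, t)) d s ∧ d ^ 2 ≤ τ (s, t))
    (hd2 : ∀ s t, ∃ d, HasDerivAt (fun r => F (s, r)) d t ∧ d ^ 2 ≤ τ (s, t)) {a : ℝ}
    (ha : L ^ 2 * a = ∫ p, F p ∂(segMeasure L).prod (segMeasure L)) :
    ∫ p, (F p - a) ^ 2 ∂(segMeasure L).prod (segMeasure L) ≤
      4 * L ^ 2 * ∫ p, τ p ∂(segMeasure L).prod (segMeasure L) := by
  set μ := segMeasure L
  have hμ : μ.real Set.univ = L := segMeasure_real_univ hL.le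
  have hμμ : (μ.prod μ).real Set.univ = L ^ 2 := by
    rw [← Set.univ_prod_univ, measureReal_prod_prod, hμ, sq]
  set K := ∫ p, τ p ∂μ.prod μ
  set P : ℝ → ℝ := fun t => ∫ s, τ (s, t) ∂μ
  set R : ℝ → ℝ := fun s => ∫ t, τ (s, t) ∂μ
  have hP : Continuous P := continuous_integral_segMeasure_right hτ L
  have hR : Continuous R := continuous_integral_segMeasure_left hτ L
  have hPi : Integrable (fun q : ℝ × ℝ => P q.2) (μ.prod μ) :=
    (hP.comp continuous_snd).integrable_segMeasure_prod L
  have hRi : Integrable (fun q : ℝ × ℝ => R q.1) (μ.prod μ) :=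
    (hR.comp continuous_fst).integrable_segMeasure_prod L
  have hPK : ∫ t, P t ∂μ = K := (integral_prod_symm _ (hτ.integrable_segMeasure_prod L)).symm
  have hRK : ∫ s, R s ∂μ = K := (integral_prod _ (hτ.integrable_segMeasure_prod L)).symm
  have hmem : ∀ᵐ p ∂μ.prod μ, p ∈ Set.Icc 0 L ×ˢ Set.Icc 0 L := by
    rw [Measure.prod_restrict]
    exact ae_restrict_mem (measurableSet_Icc.prod measurableSet_Icc)
  have hIF := hF.integrable_segMeasure_prod L
  have hIF2 : Integrable (fun q => F q ^ 2) (μ.prod μ) := (hF.pow 2).integrable_segMeasure_prod L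
  have key : ∀ p ∈ Set.Icc 0 L ×ˢ Set.Icc 0 L,
      L ^ 2 * (F p - a) ^ 2 ≤ 2 * L ^ 3 * P p.2 + 2 * L ^ 2 * K := by
    rintro ⟨s, t⟩ ⟨hs, ht⟩
    have h1 : ∫ q, (F (s, t) - F q) ^ 2 ∂μ.prod μ ≤ ∫ q, (2 * L * P t + 2 * L * R q.1) ∂μ.prod μ := by
      refine integral_mono_ae
        (((continuous_const.sub hF).pow 2).integrable_segMeasure_prod L)
        ((continuous_const.add (continuous_const.mul
          (hR.comp continuous_fst))).integrable_segMeasure_prod L) ?_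
      filter_upwards [hmem]
      rintro ⟨s', t'⟩ ⟨hs', ht'⟩
      have e1 := sq_sub_le_integral_segMeasure hL.le (h := fun r => F (r, t))
        (k := fun r => τ (r, t)) (by fun_prop) (fun r => hd1 r t) hs' hs
      have e2 := sq_sub_le_integral_segMeasure hL.le (h := fun r => F (s', r))
        (k := fun r => τ (s', r)) (by fun_prop) (fun r => hd2 s' r) ht' ht
      change (F (s, t) - F (s', t)) ^ 2 ≤ L * P t at e1
      change (F (s', t) - F (s', t')) ^ 2 ≤ L * R s' at e2
      change (F (s, t) - F (s', t')) ^ 2 ≤ 2 * L * P t + 2 * L * R s'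
      nlinarith [sq_nonneg ((F (s, t) - F (s', t)) - (F (s', t) - F (s', t')))]
    have h2 : ∫ q, (2 * L * P t + 2 * L * R q.1) ∂μ.prod μ = 2 * L ^ 3 * P t + 2 * L ^ 2 * K := by
      rw [integral_const_add_mul hRi,
        integral_fun_fst, hRK, hμ, hμμ, smul_eq_mul]
      ring
    have h3 : ∫ q, (F (s, t) - F q) ^ 2 ∂μ.prod μ =
        ∫ q, F q ^ 2 ∂μ.prod μ - 2 * F (s, t) * (L ^ 2 * a) + L ^ 2 * F (s, t) ^ 2 := by
      rw [ha, ← hμμ, ← integral_sub_const_sq hIF hIF2]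
      congr 1 with q
      ring
    have h4 := sq_integral_le_measureReal_mul hIF hIF2
    rw [hμμ, ← ha] at h4
    have h5 : L ^ 2 * a ^ 2 ≤ ∫ q, F q ^ 2 ∂μ.prod μ := by
      have : L ^ 2 * (L ^ 2 * a ^ 2) ≤ L ^ 2 * ∫ q, F q ^ 2 ∂μ.prod μ := by linarith
      exact le_of_mul_le_mul_left this (by positivity)
    change L ^ 2 * (F (s, t) - a) ^ 2 ≤ 2 * L ^ 3 * P t + 2 * L ^ 2 * K
    nlinarith
  have h6 : ∫ p, L ^ 2 * (F p - a) ^ 2 ∂μ.prod μ ≤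
      ∫ p, (2 * L ^ 2 * K + 2 * L ^ 3 * P p.2) ∂μ.prod μ := by
    refine integral_mono_ae
      ((continuous_const.mul ((hF.sub continuous_const).pow 2)).integrable_segMeasure_prod L)
      ((continuous_const.add (continuous_const.mul
        (hP.comp continuous_snd))).integrable_segMeasure_prod L) ?_
    filter_upwards [hmem] with p hp
    linarith [key p hp]
  rw [integral_const_mul,
    integral_const_add_mul hPi,
    integral_fun_snd, hPK, hμ, hμμ, smul_eq_mul] at h6
  have : L ^ 2 * ∫ p, (F p - a) ^ 2 ∂μ.prod μ ≤ L ^ 2 * (4 * L ^ 2 * K) := by linarith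
  exact le_of_mul_le_mul_left this (by positivity)

theorem integral_pow_four_le_of_pos (hL : 0 < L) (hF : Continuous F) (hτ : Continuous τ)
    (hd1 : ∀ s t, ∃ d, HasDerivAt (fun r => F (r, t)) d s ∧ d ^ 2 ≤ τ (s, t))
    (hd2 : ∀ s t, ∃ d, HasDerivAt (fun r => F (s, r)) d t ∧ d ^ 2 ≤ τ (s, t)) (l : ℝ)
    (hl : 0 < l) :
    ∫ p, F p ^ 4 ∂(segMeasure L).prod (segMeasure L) ≤
      ((L⁻¹ + l) * ∫ p, F p ^ 2 ∂(segMeasure L).prod (segMeasure L) +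
        l⁻¹ * ∫ p, τ p ∂(segMeasure L).prod (segMeasure L)) ^ 2 := by
  set μ := segMeasure L
  set g : ℝ × ℝ → ℝ := fun p => l * F p ^ 2 + l⁻¹ * τ p
  have hg : Continuous g := by fun_prop
  have hF2 : Continuous fun p => F p ^ 2 := hF.pow 2
  set A : ℝ → ℝ := fun t => L⁻¹ * ∫ s, F (s, t) ^ 2 ∂μ + ∫ s, g (s, t) ∂μ
  set B : ℝ → ℝ := fun s => L⁻¹ * ∫ t, F (s, t) ^ 2 ∂μ + ∫ t, g (s, t) ∂μ
  have hA1 : Continuous fun t => ∫ s, F (s, t) ^ 2 ∂μ :=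
    continuous_integral_segMeasure_right hF2 L
  have hA2 : Continuous fun t => ∫ s, g (s, t) ∂μ := continuous_integral_segMeasure_right hg L
  have hB1 : Continuous fun s => ∫ t, F (s, t) ^ 2 ∂μ :=
    continuous_integral_segMeasure_left hF2 L
  have hB2 : Continuous fun s => ∫ t, g (s, t) ∂μ := continuous_integral_segMeasure_left hg L
  have hderiv : ∀ {h : ℝ → ℝ} {k : ℝ → ℝ}, (∀ s, ∃ d, HasDerivAt h d s ∧ d ^ 2 ≤ k s) →
      ∀ s, ∃ d, HasDerivAt (fun r => h r ^ 2) d s ∧ |d| ≤ l * h s ^ 2 + l⁻¹ * k s := by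
    intro h k hd s
    obtain ⟨d, hd, hdk⟩ := hd s
    refine ⟨_, hd.pow 2, ?_⟩
    have e : l * h s ^ 2 + l⁻¹ * d ^ 2 ≤ l * h s ^ 2 + l⁻¹ * k s := by gcongr
    refine le_trans ?_ e
    have h1 : l * (l * h s ^ 2 + l⁻¹ * d ^ 2) = (l * h s) ^ 2 + d ^ 2 := by field_simp
    simp only [Nat.cast_ofNat, Nat.add_one_sub_one, pow_one]
    rw [abs_le]
    constructor <;> refine le_of_mul_le_mul_left ?_ hl
    · nlinarith [sq_nonneg (l * h s + d)]
    · nlinarith [sq_nonneg (l * h s - d)]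
  have hAi : ∫ t, A t ∂μ = (L⁻¹ + l) * ∫ p, F p ^ 2 ∂μ.prod μ + l⁻¹ * ∫ p, τ p ∂μ.prod μ := by
    rw [integral_add ((hA1.const_mul _).integrable_segMeasure L) (hA2.integrable_segMeasure L),
      integral_const_mul, ← integral_prod_symm _ (hF2.integrable_segMeasure_prod L),
      ← integral_prod_symm _ (hg.integrable_segMeasure_prod L),
      integral_add ((hF2.const_mul _).integrable_segMeasure_prod L)
        ((hτ.const_mul _).integrable_segMeasure_prod L), integral_const_mul, integral_const_mul]
    ring
  have hBi : ∫ t, B t ∂μ = (L⁻¹ + l) * ∫ p, F p ^ 2 ∂μ.prod μ + l⁻¹ * ∫ p, τ p ∂μ.prod μ := by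
    rw [integral_add ((hB1.const_mul _).integrable_segMeasure L) (hB2.integrable_segMeasure L),
      integral_const_mul, ← integral_prod _ (hF2.integrable_segMeasure_prod L),
      ← integral_prod _ (hg.integrable_segMeasure_prod L),
      integral_add ((hF2.const_mul _).integrable_segMeasure_prod L)
        ((hτ.const_mul _).integrable_segMeasure_prod L), integral_const_mul, integral_const_mul]
    ring
  have hmem : ∀ᵐ p ∂μ.prod μ, p ∈ Set.Icc 0 L ×ˢ Set.Icc 0 L := by
    rw [Measure.prod_restrict]
    exact ae_restrict_mem (measurableSet_Icc.prod measurableSet_Icc)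
  calc ∫ p, F p ^ 4 ∂μ.prod μ ≤ ∫ p, B p.1 * A p.2 ∂μ.prod μ := by
        refine integral_mono_ae ((hF.pow 4).integrable_segMeasure_prod L)
          (Continuous.integrable_segMeasure_prod (by fun_prop) L) ?_
        filter_upwards [hmem]
        rintro ⟨s, t⟩ ⟨hs, ht⟩
        have e1 : F (s, t) ^ 2 ≤ A t :=
          le_average_add_integral_segMeasure hL (h := fun r => F (r, t) ^ 2)
            (k := fun r => g (r, t)) (by fun_prop)
            (hderiv (h := fun r => F (r, t)) (fun r => hd1 r t)) hs
        have e2 : F (s, t) ^ 2 ≤ B s :=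
          le_average_add_integral_segMeasure hL (h := fun r => F (s, r) ^ 2)
            (k := fun r => g (s, r)) (by fun_prop)
            (hderiv (h := fun r => F (s, r)) (fun r => hd2 s r)) ht
        calc F (s, t) ^ 4 = F (s, t) ^ 2 * F (s, t) ^ 2 := by ring
          _ ≤ B s * A t := mul_le_mul e2 e1 (sq_nonneg _) ((sq_nonneg _).trans e2)
    _ = _ := by rw [integral_prod_mul, hAi, hBi, sq]

/-- Sobolev–Poincaré inequality on a square, in the form in which the gradient is controlled by a
continuous function `τ`. -/
theorem integral_pow_four_sub_average_le (hL : 0 < L) (hF : Continuous F) (hτ : Continuous τ)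
    (hd1 : ∀ s t, ∃ d, HasDerivAt (fun r => F (r, t)) d s ∧ d ^ 2 ≤ τ (s, t))
    (hd2 : ∀ s t, ∃ d, HasDerivAt (fun r => F (s, r)) d t ∧ d ^ 2 ≤ τ (s, t)) {a : ℝ}
    (ha : L ^ 2 * a = ∫ p, F p ∂(segMeasure L).prod (segMeasure L)) :
    ∫ p, (F p - a) ^ 4 ∂(segMeasure L).prod (segMeasure L) ≤
      16 * (∫ p, F p ^ 2 ∂(segMeasure L).prod (segMeasure L)) *
        ∫ p, τ p ∂(segMeasure L).prod (segMeasure L) := by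
  have hW := integral_sq_sub_average_le hL hF hτ hd1 hd2 ha
  have hX := integral_pow_four_le_of_pos (F := fun p => F p - a) hL (hF.sub continuous_const) hτ
    (fun s t => (hd1 s t).imp fun d h => ⟨h.1.sub_const a, h.2⟩)
    (fun s t => (hd2 s t).imp fun d h => ⟨h.1.sub_const a, h.2⟩)
  set ν := (segMeasure L).prod (segMeasure L)
  have hμμ : ν.real Set.univ = L ^ 2 := by
    rw [← Set.univ_prod_univ, measureReal_prod_prod, segMeasure_real_univ hL.le, sq]
  have hWF : ∫ p, (F p - a) ^ 2 ∂ν ≤ ∫ p, F p ^ 2 ∂ν := by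
    rw [integral_sub_const_sq (hF.integrable_segMeasure_prod L)
      ((hF.pow 2).integrable_segMeasure_prod L), ← ha, hμμ]
    nlinarith [sq_nonneg (L * a)]
  have hW0 : 0 ≤ ∫ p, (F p - a) ^ 2 ∂ν := integral_nonneg fun p => sq_nonneg _
  have hK0 : 0 ≤ ∫ p, τ p ∂ν := integral_nonneg fun p => by
    obtain ⟨d, -, h⟩ := hd1 p.1 p.2
    exact (sq_nonneg d).trans h
  set W := ∫ p, (F p - a) ^ 2 ∂ν
  set K := ∫ p, τ p ∂ν
  set X := ∫ p, (F p - a) ^ 4 ∂ν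
  suffices h : X ≤ 16 * W * K from h.trans (by gcongr)
  rcases hW0.eq_or_lt with h0 | h0
  · rw [← h0, mul_zero, zero_mul]
    refine le_of_forall_pos_le_add fun ε hε => ?_
    have h1 := hX ((K + 1) / √ε) (by positivity)
    rw [← h0, mul_zero, zero_add] at h1
    refine h1.trans ?_
    rw [zero_add, inv_div, div_mul_eq_mul_div, div_pow, mul_pow, Real.sq_sqrt hε.le,
      div_le_iff₀ (by positivity)]
    gcongr
    linarith
  · have hK : 0 < K := by
      by_contra! h
      have : K = 0 := le_antisymm h hK0
      rw [this, mul_zero] at hW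
      linarith
    set w := √W
    set κ := √K
    have hw : 0 < w := Real.sqrt_pos.2 h0
    have hκ : 0 < κ := Real.sqrt_pos.2 hK
    have hw2 : W = w ^ 2 := (Real.sq_sqrt hW0).symm
    have hκ2 : K = κ ^ 2 := (Real.sq_sqrt hK0).symm
    have hwκ : w ≤ 2 * L * κ := by
      refine le_of_sq_le_sq ?_ (by positivity)
      rw [← hw2, mul_pow, ← hκ2]
      linarith
    have h1 := hX (κ / w) (by positivity)
    have h2 : (L⁻¹ + κ / w) * W + (κ / w)⁻¹ * K = w * (L⁻¹ * w + 2 * κ) := by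
      rw [hw2, hκ2]
      field_simp
      ring
    have h3 : L⁻¹ * w ≤ 2 * κ := by
      rw [inv_mul_le_iff₀ hL]
      linarith
    rw [h2] at h1
    refine h1.trans ?_
    calc (w * (L⁻¹ * w + 2 * κ)) ^ 2 ≤ (w * (2 * κ + 2 * κ)) ^ 2 := by gcongr
      _ = _ := by rw [hw2, hκ2]; ring

end Square

theorem IsometryEquiv.apply_eq_linear_add (f : ℂ ≃ᵢ ℂ) (z : ℂ) :
    f z = f.toRealLinearIsometryEquiv z + f 0 := by
  rw [IsometryEquiv.toRealLinearIsometryEquiv_apply]; ring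

/-- The parametrization `(s, t) ↦ f (s + i t)` of the plane attached to a plane isometry. -/
def planeChart (f : ℂ ≃ᵢ ℂ) : ℝ × ℝ ≃ᵐ ℂ :=
  Complex.measurableEquivRealProd.symm.trans f.toHomeomorph.toMeasurableEquiv

theorem planeChart_apply (f : ℂ ≃ᵢ ℂ) (p : ℝ × ℝ) : planeChart f p = f ⟨p.1, p.2⟩ := rfl

theorem planeChart_eq (f : ℂ ≃ᵢ ℂ) (s t : ℝ) :
    planeChart f (s, t) = s * f.toRealLinearIsometryEquiv 1 +
      t * f.toRealLinearIsometryEquiv Complex.I + f 0 := by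
  have : (⟨s, t⟩ : ℂ) = s • (1 : ℂ) + t • Complex.I := by
    apply Complex.ext <;> simp
  rw [planeChart_apply, f.apply_eq_linear_add, this, map_add, map_smul, map_smul]
  simp

theorem continuous_planeChart (f : ℂ ≃ᵢ ℂ) : Continuous (planeChart f) := by
  have : (planeChart f : ℝ × ℝ → ℂ) = fun p => p.1 * f.toRealLinearIsometryEquiv 1 +
      p.2 * f.toRealLinearIsometryEquiv Complex.I + f 0 := by
    funext ⟨s, t⟩
    exact planeChart_eq f s t
  rw [this]
  fun_prop

theorem measurePreserving_planeChart (f : ℂ ≃ᵢ ℂ) :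
    MeasurePreserving (planeChart f) volume volume := by
  have h1 : MeasurePreserving f volume volume := by
    have : (f : ℂ → ℂ) = (fun z => z + f 0) ∘ f.toRealLinearIsometryEquiv := by
      funext z
      exact f.apply_eq_linear_add z
    rw [this]
    exact (measurePreserving_add_right volume (f 0)).comp
      f.toRealLinearIsometryEquiv.measurePreserving
  exact h1.comp (Complex.volume_preserving_equiv_real_prod.symm)

section PlaneSquare

variable {L : ℝ} {f : ℂ ≃ᵢ ℂ} {Q : Set ℂ}

theorem planeChart_preimage
    (hQ : Q = f '' {z : ℂ | z.re ∈ Set.Ioo 0 L ∧ z.im ∈ Set.Ioo 0 L}) :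
    planeChart f ⁻¹' Q = Set.Ioo 0 L ×ˢ Set.Ioo 0 L := by
  ext p
  rw [hQ, Set.mem_preimage, planeChart_apply, f.injective.mem_set_image]
  rfl

theorem measurableSet_of_eq_image
    (hQ : Q = f '' {z : ℂ | z.re ∈ Set.Ioo 0 L ∧ z.im ∈ Set.Ioo 0 L}) : MeasurableSet Q := by
  rw [← (planeChart f).measurableSet_preimage, planeChart_preimage hQ]
  exact measurableSet_Ioo.prod measurableSet_Ioo

theorem volume_restrict_Ioo_prod (L : ℝ) :
    (volume : Measure (ℝ × ℝ)).restrict (Set.Ioo 0 L ×ˢ Set.Ioo 0 L) =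
      (segMeasure L).prod (segMeasure L) := by
  rw [Measure.volume_eq_prod, ← Measure.prod_restrict, Measure.restrict_congr_set Ioo_ae_eq_Icc]

theorem setIntegral_eq_integral_planeChart
    (hQ : Q = f '' {z : ℂ | z.re ∈ Set.Ioo 0 L ∧ z.im ∈ Set.Ioo 0 L}) (φ : ℂ → ℝ) :
    ∫ y in Q, φ y = ∫ p, φ (planeChart f p) ∂(segMeasure L).prod (segMeasure L) := by
  rw [← (measurePreserving_planeChart f).setIntegral_preimage_emb
    (planeChart f).measurableEmbedding, planeChart_preimage hQ, volume_restrict_Ioo_prod]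

theorem volume_toReal_of_eq_image (hL : 0 ≤ L)
    (hQ : Q = f '' {z : ℂ | z.re ∈ Set.Ioo 0 L ∧ z.im ∈ Set.Ioo 0 L}) :
    (volume Q).toReal = L ^ 2 := by
  rw [← (measurePreserving_planeChart f).measure_preimage
    (measurableSet_of_eq_image hQ).nullMeasurableSet, planeChart_preimage hQ,
    Measure.volume_eq_prod, Measure.prod_prod, Real.volume_Ioo, ENNReal.toReal_mul, sub_zero,
    ENNReal.toReal_ofReal hL, sq]

end PlaneSquare

theorem hasDerivAt_sqrt_add_sq {g : ℝ → ℝ} {d s ε : ℝ} (hε : 0 < ε) (hg : 0 ≤ g s) {T : ℝ}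
    (hT : 0 ≤ T) (hd : HasDerivAt g d s) (hdT : d ^ 2 ≤ 4 * g s * T) :
    ∃ d', HasDerivAt (fun r => √(g r + ε ^ 2)) d' s ∧ d' ^ 2 ≤ T := by
  have hpos : 0 < g s + ε ^ 2 := by positivity
  refine ⟨_, (hd.add_const (ε ^ 2)).sqrt hpos.ne', ?_⟩
  rw [div_pow, mul_pow, Real.sq_sqrt hpos.le, div_le_iff₀ (by positivity)]
  nlinarith [mul_nonneg hT (sq_nonneg ε)]

theorem add_pow_four_le {x y : ℝ} : (x + y) ^ 4 ≤ 8 * (x ^ 4 + y ^ 4) := by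
  have h1 : (x + y) ^ 2 ≤ 2 * (x ^ 2 + y ^ 2) := by nlinarith [sq_nonneg (x - y)]
  have h2 : (x ^ 2 + y ^ 2) ^ 2 ≤ 2 * (x ^ 4 + y ^ 4) := by nlinarith [sq_nonneg (x ^ 2 - y ^ 2)]
  calc (x + y) ^ 4 = ((x + y) ^ 2) ^ 2 := by ring
    _ ≤ (2 * (x ^ 2 + y ^ 2)) ^ 2 := by gcongr
    _ ≤ _ := by nlinarith

/-- Sobolev–Poincaré inequality for the square root of a density `ρ` on a plane square, with the
gradient of the root controlled by `T` through `|∇ρ|² ≤ 4 ρ T`. -/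
theorem setIntegral_sqrt_sub_pow_four_le {ρ T : ℂ → ℝ} (hρ : Continuous ρ) (hT : Continuous T)
    (hρ0 : ∀ y, 0 ≤ ρ y) (hT0 : ∀ y, 0 ≤ T y)
    (hd : ∀ y e : ℂ, ‖e‖ = 1 →
      ∃ d, HasDerivAt (fun r : ℝ => ρ (y + r * e)) d 0 ∧ d ^ 2 ≤ 4 * ρ y * T y)
    {Q : Set ℂ} (hQ : IsPlaneSquare Q) :
    ∫ y in Q, (max (√(ρ y) - √((∫ z in Q, ρ z) / (volume Q).toReal)) 0) ^ 4 ≤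
      128 * (∫ y in Q, ρ y) * ∫ y in Q, T y := by
  obtain ⟨L, hL, f, hQ⟩ := hQ
  rw [volume_toReal_of_eq_image hL.le hQ]
  simp only [setIntegral_eq_integral_planeChart hQ]
  set ν := (segMeasure L).prod (segMeasure L)
  have hΦ := continuous_planeChart f
  set Φ := planeChart f
  set I := ∫ p, ρ (Φ p) ∂ν
  set K := ∫ p, T (Φ p) ∂ν
  have hν : ν.real Set.univ = L ^ 2 := by
    rw [← Set.univ_prod_univ, measureReal_prod_prod, segMeasure_real_univ hL.le, sq]
  have hρi : Integrable (fun p => ρ (Φ p)) ν := (hρ.comp hΦ).integrable_segMeasure_prod L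
  have hI : 0 ≤ I := integral_nonneg fun p => hρ0 _
  have hline : ∀ (s : ℝ) (e y : ℂ), ‖e‖ = 1 →
      ∃ d, HasDerivAt (fun r : ℝ => ρ (y + (r - s : ℝ) * e)) d s ∧ d ^ 2 ≤ 4 * ρ y * T y := by
    intro s e y he
    obtain ⟨d, h1, h2⟩ := hd y e he
    refine ⟨d, ?_, h2⟩
    rw [← sub_self s] at h1
    exact h1.comp_sub_const s s
  have main : ∀ ε : ℝ, 0 < ε →
      ∫ p, (max (√(ρ (Φ p)) - √(I / L ^ 2)) 0) ^ 4 ∂ν ≤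
        8 * (16 * (I + ε ^ 2 * L ^ 2) * K) + 8 * ε ^ 4 * L ^ 2 := by
    intro ε hε
    set F : ℝ × ℝ → ℝ := fun p => √(ρ (Φ p) + ε ^ 2)
    have hF : Continuous F := by fun_prop
    set a := (∫ p, F p ∂ν) / L ^ 2
    have ha : L ^ 2 * a = ∫ p, F p ∂ν := by
      simp only [a]; field_simp
    have hF2 : ∫ p, F p ^ 2 ∂ν = I + ε ^ 2 * L ^ 2 := by
      have : ∀ p, F p ^ 2 = ε ^ 2 + 1 * ρ (Φ p) := fun p => by
        rw [one_mul, add_comm]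
        exact Real.sq_sqrt (add_nonneg (hρ0 _) (sq_nonneg ε))
      simp only [this]
      rw [integral_const_add_mul hρi, hν]
      ring
    have h4 := integral_pow_four_sub_average_le (τ := fun p => T (Φ p)) hL hF (by fun_prop)
      (fun s t => by
        obtain ⟨d, h1, h2⟩ := hline s (f.toRealLinearIsometryEquiv 1) (Φ (s, t))
          (by rw [LinearIsometryEquiv.norm_map, norm_one])
        refine hasDerivAt_sqrt_add_sq (g := fun r => ρ (Φ (r, t))) hε (hρ0 _) (hT0 _)
          (h1.congr_of_eventuallyEq (Filter.Eventually.of_forall fun r => ?_)) h2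
        simp only [Φ, planeChart_eq, Complex.ofReal_sub]
        congr 1
        ring)
      (fun s t => by
        obtain ⟨d, h1, h2⟩ := hline t (f.toRealLinearIsometryEquiv Complex.I) (Φ (s, t))
          (by rw [LinearIsometryEquiv.norm_map, Complex.norm_I])
        refine hasDerivAt_sqrt_add_sq (g := fun r => ρ (Φ (s, r))) hε (hρ0 _) (hT0 _)
          (h1.congr_of_eventuallyEq (Filter.Eventually.of_forall fun r => ?_)) h2
        simp only [Φ, planeChart_eq, Complex.ofReal_sub]
        congr 1
        ring) ha
    have ha2 : a ≤ √(I / L ^ 2) + ε := by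
      have h5 := sq_integral_le_measureReal_mul (hF.integrable_segMeasure_prod L)
        ((hF.pow 2).integrable_segMeasure_prod L)
      rw [hν, hF2, ← ha] at h5
      have h6 : a ^ 2 ≤ I / L ^ 2 + ε ^ 2 := by
        have : I / L ^ 2 + ε ^ 2 = (I + ε ^ 2 * L ^ 2) / L ^ 2 := by field_simp
        rw [this, le_div_iff₀ (by positivity)]
        have : L ^ 2 * (a ^ 2 * L ^ 2) ≤ L ^ 2 * (I + ε ^ 2 * L ^ 2) := by linarith
        exact le_of_mul_le_mul_left this (by positivity)
      refine le_of_sq_le_sq ?_ (by positivity)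
      have h7 : √(I / L ^ 2) ^ 2 = I / L ^ 2 := Real.sq_sqrt (by positivity)
      nlinarith [mul_nonneg (Real.sqrt_nonneg (I / L ^ 2)) hε.le]
    have hpt : ∀ p, (max (√(ρ (Φ p)) - √(I / L ^ 2)) 0) ^ 4 ≤ 8 * ε ^ 4 + 8 * (F p - a) ^ 4 := by
      intro p
      have h5 : √(ρ (Φ p)) ≤ F p := Real.sqrt_le_sqrt (by nlinarith)
      have h6 : max (√(ρ (Φ p)) - √(I / L ^ 2)) 0 ≤ |F p - a| + ε :=
        max_le (by linarith [le_abs_self (F p - a)]) (by positivity)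
      calc _ ≤ (|F p - a| + ε) ^ 4 := pow_le_pow_left₀ (le_max_right _ _) h6 4
        _ ≤ 8 * (|F p - a| ^ 4 + ε ^ 4) := add_pow_four_le
        _ = _ := by rw [Even.pow_abs (by decide)]; ring
    have hFa : Continuous fun p => (F p - a) ^ 4 := by fun_prop
    calc _ ≤ ∫ p, (8 * ε ^ 4 + 8 * (F p - a) ^ 4) ∂ν := by
          refine integral_mono (Continuous.integrable_segMeasure_prod ?_ L)
            (Continuous.integrable_segMeasure_prod (by fun_prop) L) hpt
          exact (((hρ.comp hΦ).sqrt.sub continuous_const).max continuous_const).pow 4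
      _ = L ^ 2 * (8 * ε ^ 4) + 8 * ∫ p, (F p - a) ^ 4 ∂ν := by
          rw [integral_const_add_mul (hFa.integrable_segMeasure_prod L), hν]
      _ ≤ L ^ 2 * (8 * ε ^ 4) + 8 * (16 * (I + ε ^ 2 * L ^ 2) * K) := by
          rw [hF2] at h4
          gcongr
      _ = _ := by ring
  have hlim : Filter.Tendsto
      (fun ε : ℝ => 8 * (16 * (I + ε ^ 2 * L ^ 2) * K) + 8 * ε ^ 4 * L ^ 2)
      (nhdsWithin 0 (Set.Ioi 0)) (nhds (128 * I * K)) := by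
    have : Continuous fun ε : ℝ => 8 * (16 * (I + ε ^ 2 * L ^ 2) * K) + 8 * ε ^ 4 * L ^ 2 := by
      fun_prop
    have h := (this.tendsto 0).mono_left (nhdsWithin_le_nhds (s := Set.Ioi 0))
    convert h using 2
    ring
  exact ge_of_tendsto hlim (Filter.eventually_of_mem self_mem_nhdsWithin main)

section Slice

variable {N : ℕ}

/-- The configuration whose `j`-th point is `y` and whose other points are given by `z`. -/
def insertPoint (j : Fin N) (y : ℂ) (z : {k : Fin N // k ≠ j} → ℂ) : Fin N → ℂ :=
  fun k => if h : k = j then y else z ⟨k, h⟩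

theorem insertPoint_self (j : Fin N) (y : ℂ) (z : {k : Fin N // k ≠ j} → ℂ) :
    insertPoint j y z j = y := by
  simp [insertPoint]

theorem insertPoint_restrict (j : Fin N) (y : ℂ) (z : {k : Fin N // k ≠ j} → ℂ) :
    (fun k : {k : Fin N // k ≠ j} => insertPoint j y z k) = z := by
  funext k
  simp [insertPoint, k.2]

theorem insertPoint_add (j : Fin N) (y v : ℂ) (z : {k : Fin N // k ≠ j} → ℂ) :
    insertPoint j (y + v) z = insertPoint j y z + Pi.single j v := by
  funext k
  by_cases h : k = j
  · subst h
    simp [insertPoint]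
  · simp [insertPoint, h]

theorem continuous_insertPoint (j : Fin N) :
    Continuous fun p : ℂ × ({k : Fin N // k ≠ j} → ℂ) => insertPoint j p.1 p.2 := by
  refine continuous_pi fun k => ?_
  by_cases h : k = j
  · simpa [insertPoint, h] using continuous_fst
  · simp only [insertPoint, h, dite_false]
    fun_prop

/-- `insertPoint` as a measurable equivalence. -/
def insertPointEquiv (j : Fin N) : ℂ × ({k : Fin N // k ≠ j} → ℂ) ≃ᵐ (Fin N → ℂ) :=
  (((MeasurableEquiv.funUnique {k : Fin N // k = j} ℂ).symm).prodCongr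
    (MeasurableEquiv.refl _)).trans
    (MeasurableEquiv.piEquivPiSubtypeProd (fun _ : Fin N => ℂ) (fun k => k = j)).symm

theorem insertPointEquiv_apply (j : Fin N) (p : ℂ × ({k : Fin N // k ≠ j} → ℂ)) :
    insertPointEquiv j p = insertPoint j p.1 p.2 := rfl

theorem measurePreserving_insertPointEquiv (j : Fin N) :
    MeasurePreserving (insertPointEquiv j) volume volume := by
  have h1 := (volume_preserving_piEquivPiSubtypeProd (fun _ : Fin N => ℂ) (fun k => k = j)).symm
  have h2 := (volume_preserving_funUnique {k : Fin N // k = j} ℂ).symm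
  rw [Subsingleton.elim (Unique.fintype : Fintype {k : Fin N // k = j})
    (Subtype.fintype fun k => k = j)] at h2
  have h3 : MeasurePreserving (((MeasurableEquiv.funUnique {k : Fin N // k = j} ℂ).symm).prodCongr
      (MeasurableEquiv.refl ({k : Fin N // k ≠ j} → ℂ))) (volume.prod volume) _ :=
    h2.prod (MeasurePreserving.id volume)
  exact h1.comp h3

theorem exists_isCompact_forall_insertPoint_notMem {S : Set (Fin N → ℂ)} (hS : IsCompact S)
    (j : Fin N) : ∃ K : Set ({k : Fin N // k ≠ j} → ℂ), IsCompact K ∧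
      ∀ y z, z ∉ K → insertPoint j y z ∉ S := by
  refine ⟨(fun x (k : {k : Fin N // k ≠ j}) => x k) '' S, hS.image (by fun_prop), ?_⟩
  intro y z hz hx
  exact hz ⟨_, hx, insertPoint_restrict j y z⟩

theorem continuous_slice {w : (Fin N → ℂ) → ℝ} (hw : Continuous w) (j : Fin N) (y : ℂ) :
    Continuous fun z => w (insertPoint j y z) :=
  hw.comp ((continuous_insertPoint j).comp (by fun_prop : Continuous fun z => (y, z)))

theorem integrable_slice {w : (Fin N → ℂ) → ℝ} (hw : Continuous w) (hs : HasCompactSupport w)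
    (j : Fin N) (y : ℂ) : Integrable fun z => w (insertPoint j y z) := by
  obtain ⟨K, hK, hKS⟩ := exists_isCompact_forall_insertPoint_notMem hs j
  exact (continuous_slice hw j y).integrable_of_hasCompactSupport
    (HasCompactSupport.intro hK fun z hz => image_eq_zero_of_notMem_tsupport (hKS y z hz))

theorem continuous_integral_slice {w : (Fin N → ℂ) → ℝ} (hw : Continuous w)
    (hs : HasCompactSupport w) (j : Fin N) :
    Continuous fun y => ∫ z, w (insertPoint j y z) := by
  obtain ⟨K, hK, hKS⟩ := exists_isCompact_forall_insertPoint_notMem hs j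
  rw [← continuousOn_univ]
  exact continuousOn_integral_of_compact_support hK
    (hw.comp (continuous_insertPoint j)).continuousOn
    fun y z _ hz => image_eq_zero_of_notMem_tsupport (hKS y z hz)

theorem hasDerivAt_integral_slice {w w' : (Fin N → ℂ) → ℝ} (hw : Continuous w)
    (hs : HasCompactSupport w) (hw' : Continuous w') (hs' : HasCompactSupport w') (j : Fin N)
    (e : ℂ) (hd : ∀ x, HasDerivAt (fun r : ℝ => w (x + Pi.single j (r * e))) (w' x) 0) (y : ℂ) :
    HasDerivAt (fun r : ℝ => ∫ z, w (insertPoint j (y + r * e) z))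
      (∫ z, w' (insertPoint j y z)) 0 := by
  obtain ⟨K, hK, hKS⟩ := exists_isCompact_forall_insertPoint_notMem hs' j
  obtain ⟨C, hC⟩ := hw'.bounded_above_of_compact_support hs'
  have h := (hasDerivAt_integral_of_dominated_loc_of_deriv_le (𝕜 := ℝ) (μ := volume) (x₀ := (0 : ℝ))
    (s := Set.univ) (F := fun r z => w (insertPoint j (y + r * e) z))
    (F' := fun r z => w' (insertPoint j (y + r * e) z)) (bound := K.indicator fun _ => C)
    Filter.univ_mem
    (Filter.Eventually.of_forall fun r => (continuous_slice hw j _).aestronglyMeasurable)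
    (integrable_slice hw hs j _) (continuous_slice hw' j _).aestronglyMeasurable
    (Filter.Eventually.of_forall fun z r _ => ?_)
    ((integrable_indicator_iff hK.measurableSet).2 (integrableOn_const hK.measure_ne_top))
    (Filter.Eventually.of_forall fun z r _ => ?_)).2
  · simpa using h
  · by_cases hz : z ∈ K
    · simpa [hz] using hC _
    · simp [hz, image_eq_zero_of_notMem_tsupport (hKS (y + r * e) z hz)]
  · have h1 := hd (insertPoint j (y + r * e) z)
    rw [← sub_self r] at h1
    refine (h1.comp_sub_const r r).congr_of_eventuallyEq (Filter.Eventually.of_forall fun q => ?_)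
    simp only [← insertPoint_add]
    congr 2
    push_cast
    ring

end Slice

section Anyon

variable {N : ℕ} {u : (Fin N → ℂ) → ℂ} {α : ℝ}

theorem covSq_nonneg (α : ℝ) (u : (Fin N → ℂ) → ℂ) (j : Fin N) (x : Fin N → ℂ) :
    0 ≤ covSq α u j x := by
  unfold covSq
  positivity

theorem covSq_eq_zero {x : Fin N → ℂ} (hx : x ∉ tsupport u) (j : Fin N) : covSq α u j x = 0 := by
  have h1 : u x = 0 := image_eq_zero_of_notMem_tsupport hx
  have h2 : fderiv ℝ u x = 0 :=
    image_eq_zero_of_notMem_tsupport fun h => hx (tsupport_fderiv_subset ℝ h)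
  simp [covSq, h1, h2]

theorem tsupport_covSq_subset (j : Fin N) :
    tsupport (covSq α u j) ⊆ tsupport u :=
  closure_minimal (fun _ hx => by_contra fun h => hx (covSq_eq_zero h j)) (isClosed_tsupport u)

theorem IsAnyonWF.hasCompactSupport_covSq (hu : IsAnyonWF N u) (j : Fin N) :
    HasCompactSupport (covSq α u j) :=
  HasCompactSupport.intro hu.compactSupport fun _ hx => covSq_eq_zero hx j

theorem IsAnyonWF.continuous_fderiv_apply (hu : IsAnyonWF N u) (v : Fin N → ℂ) :
    Continuous fun x => fderiv ℝ u x v :=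
  (hu.smooth.continuous_fderiv (by simp)).clm_apply continuous_const

theorem IsAnyonWF.continuous_covSq (hu : IsAnyonWF N u) (j : Fin N) :
    Continuous (covSq α u j) := by
  refine continuous_of_tsupport fun x hx => ?_
  have hx' := hu.offDiagonal x (tsupport_covSq_subset j hx)
  have hA : ContinuousAt (fun x : Fin N → ℂ => (α : ℂ) * ∑ k ∈ Finset.univ.erase j,
      Complex.I * (x j - x k) / ((‖x j - x k‖ : ℂ) ^ 2)) x := by
    refine continuousAt_const.mul (tendsto_finsetSum _ fun k hk => ?_)
    have hne : x j - x k ≠ 0 := sub_ne_zero.2 (hx' j k (Finset.ne_of_mem_erase hk).symm)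
    refine ContinuousAt.div (by fun_prop) (by fun_prop) ?_
    simpa using hne
  have hu0 := hu.smooth.continuous.continuousAt (x := x)
  have h1 := (hu.continuous_fderiv_apply (Pi.single j 1)).continuousAt (x := x)
  have h2 := (hu.continuous_fderiv_apply (Pi.single j Complex.I)).continuousAt (x := x)
  have hre := Complex.continuous_ofReal.continuousAt.comp (Complex.continuous_re.continuousAt.comp hA)
  have him := Complex.continuous_ofReal.continuousAt.comp (Complex.continuous_im.continuousAt.comp hA)
  exact (((continuousAt_const.mul h1).add (hre.mul hu0)).norm.pow 2).add
    (((continuousAt_const.mul h2).add (him.mul hu0)).norm.pow 2)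

theorem covariant_sq_completion (v v₁ v₂ : ℂ) (a b c s l : ℝ) (h : c ^ 2 + s ^ 2 = 1) :
    0 ≤ ‖v‖ ^ 2 * (l * l) + 2 * inner ℝ v (c • v₁ + s • v₂) * l +
      (‖-Complex.I * v₁ + (a : ℂ) * v‖ ^ 2 + ‖-Complex.I * v₂ + (b : ℂ) * v‖ ^ 2) := by
  have e : ‖v‖ ^ 2 * (l * l) + 2 * inner ℝ v (c • v₁ + s • v₂) * l +
      (‖-Complex.I * v₁ + (a : ℂ) * v‖ ^ 2 + ‖-Complex.I * v₂ + (b : ℂ) * v‖ ^ 2) =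
      ‖-Complex.I * v₁ + (a : ℂ) * v - Complex.I * (l * c : ℝ) * v‖ ^ 2 +
        ‖-Complex.I * v₂ + (b : ℂ) * v - Complex.I * (l * s : ℝ) * v‖ ^ 2 := by
    simp only [Complex.sq_norm, Complex.normSq_apply, Complex.inner, Complex.add_re,
      Complex.add_im, Complex.sub_re, Complex.sub_im, Complex.mul_re, Complex.mul_im,
      Complex.neg_re, Complex.neg_im, Complex.I_re, Complex.I_im, Complex.ofReal_re,
      Complex.ofReal_im, Complex.conj_re, Complex.conj_im, Complex.smul_re, Complex.smul_im,
      smul_eq_mul]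
    linear_combination (-(v.re ^ 2 + v.im ^ 2) * l ^ 2) * h
  rw [e]
  positivity

theorem fderiv_apply_single (u : (Fin N → ℂ) → ℂ) (x : Fin N → ℂ) (j : Fin N) (e : ℂ) :
    fderiv ℝ u x (Pi.single j e) =
      e.re • fderiv ℝ u x (Pi.single j 1) + e.im • fderiv ℝ u x (Pi.single j Complex.I) := by
  rw [← map_smul, ← map_smul, ← map_add]
  congr 1
  rw [← Pi.single_smul, ← Pi.single_smul, ← Pi.single_add]
  congr 1
  apply Complex.ext <;> simp

theorem covSq_completion (u : (Fin N → ℂ) → ℂ) (j : Fin N) (x : Fin N → ℂ) {e : ℂ}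
    (he : ‖e‖ = 1) (l : ℝ) :
    0 ≤ ‖u x‖ ^ 2 * (l * l) + 2 * inner ℝ (u x) (fderiv ℝ u x (Pi.single j e)) * l +
      covSq α u j x := by
  rw [fderiv_apply_single]
  refine covariant_sq_completion _ _ _ _ _ _ _ _ ?_
  have : ‖e‖ ^ 2 = 1 := by rw [he, one_pow]
  rw [Complex.sq_norm, Complex.normSq_apply] at this
  linarith

/-- The kinetic energy density of `u`, as a function of the position of one particle. -/
def kineticDensity (α : ℝ) (u : (Fin N → ℂ) → ℂ) (y : ℂ) : ℝ :=
  ∑ j : Fin N, ∫ z, covSq α u j (insertPoint j y z)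

theorem density_eq (u : (Fin N → ℂ) → ℂ) (y : ℂ) :
    density N u y = ∑ j : Fin N, ∫ z, ‖u (insertPoint j y z)‖ ^ 2 := rfl

theorem density_nonneg (u : (Fin N → ℂ) → ℂ) (y : ℂ) : 0 ≤ density N u y :=
  Finset.sum_nonneg fun _ _ => integral_nonneg fun _ => sq_nonneg _

theorem kineticDensity_nonneg (u : (Fin N → ℂ) → ℂ) (y : ℂ) : 0 ≤ kineticDensity α u y :=
  Finset.sum_nonneg fun _ _ => integral_nonneg fun _ => covSq_nonneg _ _ _ _

namespace IsAnyonWF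

theorem continuous_norm_sq (hu : IsAnyonWF N u) : Continuous fun x => ‖u x‖ ^ 2 :=
  hu.smooth.continuous.norm.pow 2

theorem hasCompactSupport_norm_sq (hu : IsAnyonWF N u) :
    HasCompactSupport fun x => ‖u x‖ ^ 2 :=
  hu.compactSupport.comp_left (g := fun z : ℂ => ‖z‖ ^ 2) (by simp)

theorem continuous_density (hu : IsAnyonWF N u) : Continuous (density N u) := by
  simp only [funext (density_eq u)]
  exact continuous_finsetSum _ fun j _ =>
    continuous_integral_slice hu.continuous_norm_sq hu.hasCompactSupport_norm_sq j

theorem continuous_kineticDensity (hu : IsAnyonWF N u) : Continuous (kineticDensity α u) :=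
  continuous_finsetSum _ fun j _ =>
    continuous_integral_slice (hu.continuous_covSq j) (hu.hasCompactSupport_covSq j) j

theorem exists_hasDerivAt_density (hu : IsAnyonWF N u) (α : ℝ) (y : ℂ) {e : ℂ} (he : ‖e‖ = 1) :
    ∃ d, HasDerivAt (fun r : ℝ => density N u (y + r * e)) d 0 ∧
      d ^ 2 ≤ 4 * density N u y * kineticDensity α u y := by
  set w' : Fin N → (Fin N → ℂ) → ℝ :=
    fun j x => 2 * inner ℝ (u x) (fderiv ℝ u x (Pi.single j e))
  have hw' : ∀ j, Continuous (w' j) := fun j =>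
    continuous_const.mul (hu.smooth.continuous.inner (hu.continuous_fderiv_apply _))
  have hs' : ∀ j, HasCompactSupport (w' j) := fun j =>
    HasCompactSupport.intro hu.compactSupport fun x hx => by
      simp [w', image_eq_zero_of_notMem_tsupport hx]
  refine ⟨∑ j, ∫ z, w' j (insertPoint j y z), ?_, ?_⟩
  · simp only [density_eq]
    refine HasDerivAt.fun_sum fun j _ => ?_
    refine hasDerivAt_integral_slice hu.continuous_norm_sq hu.hasCompactSupport_norm_sq
      (hw' j) (hs' j) j e (fun x => ?_) y
    have hline : HasDerivAt (fun r : ℝ => x + Pi.single j (r * e)) (Pi.single j e) 0 := by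
      have h := ((hasDerivAt_id (0 : ℝ)).smul_const (Pi.single j e : Fin N → ℂ)).const_add x
      rw [one_smul] at h
      refine h.congr_of_eventuallyEq (Filter.Eventually.of_forall fun r => ?_)
      simp [← Pi.single_smul]
    have hx : x + Pi.single j (((0 : ℝ) : ℂ) * e) = x := by simp
    have hux : HasFDerivAt u (fderiv ℝ u x) (x + Pi.single j (((0 : ℝ) : ℂ) * e)) := by
      rw [hx]
      exact (hu.smooth.differentiable (by simp) x).hasFDerivAt
    have h := (hux.comp_hasDerivAt (0 : ℝ) hline).norm_sq
    simpa [w'] using h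
  · have hquad : ∀ l : ℝ, 0 ≤ density N u y * (l * l) +
        (∑ j, ∫ z, w' j (insertPoint j y z)) * l + kineticDensity α u y := by
      intro l
      rw [density_eq, kineticDensity, Finset.sum_mul, Finset.sum_mul, ← Finset.sum_add_distrib,
        ← Finset.sum_add_distrib]
      refine Finset.sum_nonneg fun j _ => ?_
      have i1 := (integrable_slice hu.continuous_norm_sq
        hu.hasCompactSupport_norm_sq j y).mul_const (l * l)
      have i2 := (integrable_slice (hw' j) (hs' j) j y).mul_const l
      have i12 : Integrable fun z => ‖u (insertPoint j y z)‖ ^ 2 * (l * l) +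
          w' j (insertPoint j y z) * l := i1.add i2
      have i3 := integrable_slice (hu.continuous_covSq (α := α) j)
        (hu.hasCompactSupport_covSq j) j y
      rw [← integral_mul_const, ← integral_mul_const, ← integral_add i1 i2,
        ← integral_add i12 i3]
      exact integral_nonneg fun z => covSq_completion u j _ he l
    have := discrim_le_zero hquad
    rw [discrim] at this
    linarith

theorem ofReal_setIntegral_kineticDensity (hu : IsAnyonWF N u) {Q : Set ℂ}
    (hQ : MeasurableSet Q) (hb : Bornology.IsBounded Q) :
    ENNReal.ofReal (∫ y in Q, kineticDensity α u y) =
      ∑ j : Fin N, ∫⁻ x : Fin N → ℂ,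
        ENNReal.ofReal (covSq α u j x * Set.indicator Q (fun _ => (1 : ℝ)) (x j)) := by
  have hcont : ∀ j : Fin N, Continuous fun y => ∫ z, covSq α u j (insertPoint j y z) := fun j =>
    continuous_integral_slice (hu.continuous_covSq j) (hu.hasCompactSupport_covSq j) j
  have hint : ∀ j : Fin N,
      IntegrableOn (fun y => ∫ z, covSq α u j (insertPoint j y z)) Q := fun j =>
    ((hcont j).continuousOn.integrableOn_compact hb.isCompact_closure).mono_set subset_closure
  have hnn : ∀ (j : Fin N) (y : ℂ), 0 ≤ ∫ z, covSq α u j (insertPoint j y z) := fun j y =>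
    integral_nonneg fun z => covSq_nonneg _ _ _ _
  simp only [kineticDensity]
  rw [integral_finsetSum _ fun j _ => hint j,
    ENNReal.ofReal_sum_of_nonneg fun j _ => integral_nonneg (hnn j)]
  refine Finset.sum_congr rfl fun j _ => ?_
  have hmeas : Measurable fun p : ℂ × ({k : Fin N // k ≠ j} → ℂ) => ENNReal.ofReal
      (covSq α u j (insertPoint j p.1 p.2) *
        Set.indicator Q (fun _ => (1 : ℝ)) (insertPoint j p.1 p.2 j)) := by
    simp only [insertPoint_self]
    refine (Measurable.mul ?_ ?_).ennreal_ofReal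
    · exact ((hu.continuous_covSq j).comp (continuous_insertPoint j)).measurable
    · exact (measurable_const.indicator hQ).comp measurable_fst
  rw [← (measurePreserving_insertPointEquiv j).lintegral_comp_emb
    (insertPointEquiv j).measurableEmbedding]
  simp only [insertPointEquiv_apply]
  rw [Measure.volume_eq_prod, lintegral_prod _ hmeas.aemeasurable,
    ofReal_integral_eq_lintegral_ofReal (hint j) (Filter.Eventually.of_forall (hnn j)),
    ← lintegral_indicator hQ]
  refine lintegral_congr fun y => ?_
  simp only [insertPoint_self]
  by_cases hy : y ∈ Q
  · simp only [hy, Set.indicator_of_mem, mul_one]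
    exact ofReal_integral_eq_lintegral_ofReal
      (integrable_slice (hu.continuous_covSq j) (hu.hasCompactSupport_covSq j) j y)
      (Filter.Eventually.of_forall fun z => covSq_nonneg _ _ _ _)
  · simp [hy]

end IsAnyonWF

end Anyon

theorem IsPlaneSquare.isBounded {Q : Set ℂ} (hQ : IsPlaneSquare Q) : Bornology.IsBounded Q := by
  obtain ⟨L, -, f, rfl⟩ := hQ
  exact f.isometry.lipschitz.isBounded_image
    ((Metric.isBounded_Ioo 0 L).reProdIm (Metric.isBounded_Ioo 0 L))

theorem IsPlaneSquare.measurableSet {Q : Set ℂ} (hQ : IsPlaneSquare Q) : MeasurableSet Q := by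
  obtain ⟨L, -, f, hQ⟩ := hQ
  exact measurableSet_of_eq_image hQ

/-- **Lemma (local uncertainty principle).** There is a universal `C₂' > 0` such that for
every `α`, every `N ≥ 2`, every normalized `N`-anyon wave function `u` with one-particle
density `ρ`, and every square `Q ⊂ ℝ²` with `∫_Q ρ > 0`,
`∑_j ∫ |D_j u|² χ_Q(x_j) ≥ C₂'·(∫_Q ρ)⁻¹·∫_Q [ρ^{1/2} − ((∫_Q ρ)/|Q|)^{1/2}]₊⁴`. -/
theorem local_uncertainty_principle :
    ∃ C : ℝ, 0 < C ∧ ∀ (α : ℝ) (N : ℕ), 2 ≤ N →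
      ∀ u : (Fin N → ℂ) → ℂ, IsAnyonWF N u → (∫ x : Fin N → ℂ, ‖u x‖ ^ 2) = 1 →
      ∀ Q : Set ℂ, IsPlaneSquare Q → 0 < ∫ y in Q, density N u y →
      ENNReal.ofReal (C * (∫ y in Q, density N u y)⁻¹ *
          ∫ y in Q, (max (Real.sqrt (density N u y) -
            Real.sqrt ((∫ z in Q, density N u z) / (volume Q).toReal)) 0) ^ 4) ≤
        ∑ j : Fin N, ∫⁻ x : Fin N → ℂ,
          ENNReal.ofReal (covSq α u j x * Set.indicator Q (fun _ => (1 : ℝ)) (x j)) := by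
  refine ⟨1 / 128, by norm_num, fun α N _ u hu _ Q hQ hI => ?_⟩
  rw [← hu.ofReal_setIntegral_kineticDensity hQ.measurableSet hQ.isBounded]
  refine ENNReal.ofReal_le_ofReal ?_
  have h := setIntegral_sqrt_sub_pow_four_le hu.continuous_density
    (hu.continuous_kineticDensity (α := α)) (density_nonneg u) (kineticDensity_nonneg u)
    (fun y _ he => hu.exists_hasDerivAt_density α y he) hQ
  rw [mul_assoc, one_div_mul_eq_div, div_le_iff₀ (by norm_num), inv_mul_le_iff₀ hI]
  linarith

end
end

section
/- Let Ω ⊆ ℝ² be a measurable set with finite positive area |Ω|, and let ρ : Ω → [0,∞) be measurable with ρ and ρ² integrable over Ω. Then for every ε > 0: ∫_Ω [ρ(x)^{1/2} − ((∫_Ω ρ)/|Ω|)^{1/2}]₊⁴ dx ≥ (1 − 4ε) ∫_Ω ρ² dx + (2 − ε^{−1}) (∫_Ω ρ)²/|Ω|. -/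
open MeasureTheory

lemma quartic_posPart_lower_bound {s a ε : ℝ} (hs : 0 ≤ s) (ha : 0 ≤ a) (hε : 0 < ε) :
    (1 - 4 * ε) * s ^ 4 + (4 - ε⁻¹) * a ^ 2 * s ^ 2 - 2 * a ^ 4 ≤ (max (s - a) 0) ^ 4 := by
  have young : 4 * s ^ 3 * a ≤ 4 * ε * s ^ 4 + ε⁻¹ * a ^ 2 * s ^ 2 := by
    have h : 0 ≤ ε⁻¹ * (2 * ε * s ^ 2 - s * a) ^ 2 := by positivity
    have h' : ε⁻¹ * (2 * ε * s ^ 2 - s * a) ^ 2 =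
        4 * ε * s ^ 4 + ε⁻¹ * a ^ 2 * s ^ 2 - 4 * s ^ 3 * a := by
      field_simp
      ring
    linarith
  rcases le_total a s with has | hsa
  · rw [max_eq_left (by linarith)]
    have h : 0 ≤ a ^ 2 * (s - a) ^ 2 := by positivity
    have h' : 0 ≤ a ^ 4 := by positivity
    nlinarith
  · rw [max_eq_right (by linarith)]
    have h : s * (2 * a - s) ≤ a ^ 2 := by nlinarith [sq_nonneg (s - a)]
    have h₀ : 0 ≤ s * (2 * a - s) := mul_nonneg hs (by linarith)
    have h' : (s * (2 * a - s)) ^ 2 ≤ (a ^ 2) ^ 2 := pow_le_pow_left₀ h₀ h 2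
    have h₁ : 0 ≤ a ^ 4 := by positivity
    nlinarith

/-- **Lemma.** For a measurable `Ω ⊆ ℝ²` (identified with `ℂ`) of finite positive area,
a measurable `ρ ≥ 0` on `Ω` with `ρ` and `ρ²` integrable over `Ω`, and any `ε > 0`,
`∫_Ω [ρ^{1/2} − ((∫_Ω ρ)/|Ω|)^{1/2}]₊⁴ ≥ (1−4ε) ∫_Ω ρ² + (2−ε⁻¹) (∫_Ω ρ)²/|Ω|`. -/
theorem neumann_integral_bound (Ω : Set ℂ) (hΩmeas : MeasurableSet Ω)
    (hΩpos : 0 < volume Ω) (hΩfin : volume Ω ≠ ⊤)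
    (ρ : ℂ → ℝ) (hρmeas : Measurable ρ) (hρnonneg : ∀ x ∈ Ω, 0 ≤ ρ x)
    (hρint : IntegrableOn ρ Ω) (hρsqint : IntegrableOn (fun x => ρ x ^ 2) Ω)
    (ε : ℝ) (hε : 0 < ε) :
    (1 - 4 * ε) * (∫ x in Ω, ρ x ^ 2) +
        (2 - ε⁻¹) * (∫ x in Ω, ρ x) ^ 2 / (volume Ω).toReal ≤
      ∫ x in Ω, (max (Real.sqrt (ρ x) -
        Real.sqrt ((∫ y in Ω, ρ y) / (volume Ω).toReal)) 0) ^ 4 := by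
  set V := (volume Ω).toReal with hV
  set I := ∫ y in Ω, ρ y with hI
  have hVpos : 0 < V := ENNReal.toReal_pos hΩpos.ne' hΩfin
  have hInonneg : 0 ≤ I := setIntegral_nonneg hΩmeas hρnonneg
  set m := I / V with hm
  have hmnonneg : 0 ≤ m := div_nonneg hInonneg hVpos.le
  have sqrt_pow_four {t : ℝ} (ht : 0 ≤ t) : √t ^ 4 = t ^ 2 := by
    rw [show √t ^ 4 = (√t ^ 2) ^ 2 by ring, Real.sq_sqrt ht]
  have pointwise : ∀ x ∈ Ω, (1 - 4 * ε) * ρ x ^ 2 + (4 - ε⁻¹) * m * ρ x - 2 * m ^ 2 ≤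
      (max (√(ρ x) - √m) 0) ^ 4 := fun x hx => by
    have h := quartic_posPart_lower_bound (Real.sqrt_nonneg (ρ x)) (Real.sqrt_nonneg m) hε
    rwa [sqrt_pow_four (hρnonneg x hx), sqrt_pow_four hmnonneg,
      Real.sq_sqrt (hρnonneg x hx), Real.sq_sqrt hmnonneg] at h
  have hrhs : IntegrableOn (fun x => (max (√(ρ x) - √m) 0) ^ 4) Ω := by
    refine hρsqint.mono' (by fun_prop) ?_
    filter_upwards [ae_restrict_mem hΩmeas] with x hx
    rw [Real.norm_of_nonneg (by positivity), ← sqrt_pow_four (hρnonneg x hx)]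
    gcongr
    exact max_le (sub_le_self _ (Real.sqrt_nonneg m)) (Real.sqrt_nonneg _)
  have hconst : IntegrableOn (fun _ : ℂ => 2 * m ^ 2) Ω := integrableOn_const hΩfin
  have hsq := hρsqint.const_mul (1 - 4 * ε)
  have hlin := hρint.const_mul ((4 - ε⁻¹) * m)
  have hadd : IntegrableOn (fun x => (1 - 4 * ε) * ρ x ^ 2 + (4 - ε⁻¹) * m * ρ x) Ω :=
    hsq.add hlin
  have hlhs : IntegrableOn
      (fun x => (1 - 4 * ε) * ρ x ^ 2 + (4 - ε⁻¹) * m * ρ x - 2 * m ^ 2) Ω :=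
    hadd.sub hconst
  calc (1 - 4 * ε) * (∫ x in Ω, ρ x ^ 2) + (2 - ε⁻¹) * I ^ 2 / V
      = ∫ x in Ω, ((1 - 4 * ε) * ρ x ^ 2 + (4 - ε⁻¹) * m * ρ x - 2 * m ^ 2) := by
        rw [integral_sub hadd hconst, integral_add hsq hlin, integral_const_mul,
          integral_const_mul, setIntegral_const, ← hI, smul_eq_mul, measureReal_def, ← hV, hm]
        field_simp
        ring
    _ ≤ _ := setIntegral_mono_on hlhs hrhs hΩmeas pointwise
end
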